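/- For every (T,φ) ∈ OP_Γ, the linear span of the cone σ(T,φ) equals ∩_{e ∈ T} {v ∈ H₁(Γ,ℝ) : (v,e⃗) = 0} = H₁(Γ∖T,ℝ), and hence has dimension b₁(Γ∖T). -/

import Mathlib

/-!
Serre-style finite graphs: a vertex type `V`, an oriented-edge type `E` with a
fixed-point-free involution `inv` (edge reversal) and source/target maps `s, t`
with `s (inv e) = t e`.  An unoriented edge is an `inv`-orbit `{e, inv e}`;
subsets of unoriented edges are encoded as `inv`-closed subsets of `E`, and an
orientation of a spanning subgraph `Γ∖T` is encoded by the set `O` of its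
positively oriented edges.  1-chains with coefficients in `A` are encoded as
functions `c : E → A` with `c (inv e) = - c e` (so that `(c, e⃗) = c e` for the
standard bilinear form).
-/

structure SerreGraph where
  V : Type
  E : Type
  [fintypeV : Fintype V]
  [fintypeE : Fintype E]
  [decEqV : DecidableEq V]
  [decEqE : DecidableEq E]
  inv : E → E
  s : E → V
  t : E → V
  inv_inv : ∀ e, inv (inv e) = e
  inv_ne : ∀ e, inv e ≠ e
  s_inv : ∀ e, s (inv e) = t e

attribute [instance] SerreGraph.fintypeV SerreGraph.fintypeE
attribute [instance] SerreGraph.decEqV SerreGraph.decEqE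

namespace SerreGraph

variable (Γ : SerreGraph)

/-- Reachability between vertices in the spanning subgraph whose allowed oriented
edges are those in `A`. -/
def Reach (A : Set Γ.E) : Γ.V → Γ.V → Prop :=
  Relation.ReflTransGen (fun a b => ∃ e ∈ A, Γ.s e = a ∧ Γ.t e = b)

/-- The number of connected components of the spanning subgraph with allowed
oriented edges `A`. -/
noncomputable def numComponents (A : Set Γ.E) : ℕ :=
  Nat.card (Quot (fun a b : Γ.V => ∃ e ∈ A, Γ.s e = a ∧ Γ.t e = b))

/-- The set of separating (oriented) edges: removing the underlying unoriented
edge increases the number of connected components. -/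
def Esep : Set Γ.E :=
  {e | Γ.numComponents Set.univ < Γ.numComponents {f | f ≠ e ∧ f ≠ Γ.inv e}}

/-- `T` encodes a set of unoriented edges. -/
def InvClosed (T : Set Γ.E) : Prop := ∀ e, e ∈ T ↔ Γ.inv e ∈ T

/-- `O` is (the set of positively oriented edges of) an orientation of `Γ∖T`. -/
def IsOrientation (T O : Set Γ.E) : Prop :=
  (∀ e ∈ O, e ∉ T) ∧ ∀ e, e ∉ T → (e ∈ O ↔ Γ.inv e ∉ O)

/-- A totally cyclic orientation of `Γ∖T`: an orientation such that there is no
vertex set `W` which is nonempty and proper inside some connected component of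
`Γ∖T` and such that all edges of `Γ∖T` crossing the boundary of `W` are oriented
out of `W` (this is the componentwise condition of the paper). -/
def IsTotallyCyclic (T O : Set Γ.E) : Prop :=
  Γ.IsOrientation T O ∧
    ¬ ∃ W : Set Γ.V, (∃ v ∈ W, ∃ w ∈ Wᶜ, Γ.Reach Tᶜ v w) ∧
        ∀ e ∈ O, Γ.t e ∈ W → Γ.s e ∈ W

/-- `γ` is (the set of positively oriented edges of) an oriented circuit of `Γ`:
a cyclic subgraph (connected, first Betti number one, no separating edges)
together with a totally cyclic orientation; equivalently a directed cycle:
each incident vertex has exactly one outgoing and one incoming edge in `γ`,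
and the support is connected. -/
def IsCircuit (γ : Finset Γ.E) : Prop :=
  γ.Nonempty ∧ (∀ e ∈ γ, Γ.inv e ∉ γ) ∧
    (∀ v ∈ γ.image Γ.s ∪ γ.image Γ.t, ∃! e, e ∈ γ ∧ Γ.s e = v) ∧
    (∀ v ∈ γ.image Γ.s ∪ γ.image Γ.t, ∃! e, e ∈ γ ∧ Γ.t e = v) ∧
    ∀ e ∈ γ, ∀ f ∈ γ, Γ.Reach ((↑γ : Set Γ.E) ∪ Γ.inv '' ↑γ) (Γ.s e) (Γ.s f)

/-- The class `[γ] ∈ H₁(Γ,ℤ)` of an oriented circuit. -/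
def circChainZ (γ : Finset Γ.E) : Γ.E → ℤ :=
  fun e => if e ∈ γ then 1 else if Γ.inv e ∈ γ then -1 else 0

/-- The class `[γ] ∈ H₁(Γ,ℝ)` of an oriented circuit. -/
noncomputable def circChainR (γ : Finset Γ.E) : Γ.E → ℝ :=
  fun e => (Γ.circChainZ γ e : ℝ)

/-- `Cir_φ(Γ∖T)`: oriented circuits of `Γ∖T` compatibly oriented with the
orientation with positive edges `O`. -/
def Cir (T O : Set Γ.E) : Set (Finset Γ.E) :=
  {γ | Γ.IsCircuit γ ∧ (∀ e ∈ γ, e ∈ O) ∧ ∀ e ∈ γ, e ∉ T}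

/-- `c` is a 1-cycle: a skew 1-chain with vanishing boundary, i.e. an element of
`H₁(Γ,A)`. -/
def IsCycle {A : Type*} [AddCommGroup A] (c : Γ.E → A) : Prop :=
  (∀ e, c (Γ.inv e) = - c e) ∧
    ∀ v, ∑ e ∈ Finset.univ.filter (fun e => Γ.t e = v), c e = 0

/-- An element of `H₁(Γ∖T, A) ⊆ H₁(Γ,A)`: a cycle supported on edges not in `T`. -/
def IsCycleOn {A : Type*} [AddCommGroup A] (T : Set Γ.E) (c : Γ.E → A) : Prop :=
  Γ.IsCycle c ∧ ∀ e ∈ T, c e = 0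

/-- The standard positive definite bilinear form on `C⃗₁(Γ,ℝ)`, for which
`(c, e⃗) = c e`. -/
noncomputable def pair (c c' : Γ.E → ℝ) : ℝ := (∑ e, c e * c' e) / 2

/-- The first Betti number `b₁(Γ) = dim_ℝ H₁(Γ,ℝ)`. -/
noncomputable def b1 : ℕ :=
  Module.finrank ℝ (Submodule.span ℝ {c : Γ.E → ℝ | Γ.IsCycle c})

/-- `b₁(Γ∖T) = dim_ℝ H₁(Γ∖T,ℝ)`. -/
noncomputable def b1Sub (T : Set Γ.E) : ℕ :=
  Module.finrank ℝ (Submodule.span ℝ {c : Γ.E → ℝ | Γ.IsCycleOn T c})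

/-- The cone `σ(T,φ) ⊆ H₁(Γ,ℝ)` of the cographic fan associated to a pair
`(T, O)` with `O` an orientation of `Γ∖T`. -/
def sigmaCone (T O : Set Γ.E) : Set (Γ.E → ℝ) :=
  {v | Γ.IsCycle v ∧ (∀ e ∈ O, 0 ≤ v e) ∧ ∀ e ∈ T, v e = 0}

/-- The poset `OP_Γ` of totally cyclic orientations: pairs `(T, O)` with `T` a
set of unoriented edges and `O` a totally cyclic orientation of `Γ∖T`. -/
def OP : Set (Set Γ.E × Set Γ.E) :=
  {p | Γ.InvClosed p.1 ∧ Γ.IsTotallyCyclic p.1 p.2}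

/-- The order on `OP_Γ`: `(T',φ') ≤ (T,φ)` iff `T' ⊇ T` and `φ'` is the
restriction of `φ`. -/
def OPle (p q : Set Γ.E × Set Γ.E) : Prop :=
  q.1 ⊆ p.1 ∧ p.2 = q.2 ∩ p.1ᶜ

/-- `H₁(Γ,ℤ)` viewed as the set of lattice points of `H₁(Γ,ℝ)`. -/
def H1Z : Set (Γ.E → ℝ) := {c | Γ.IsCycle c ∧ ∀ e, ∃ n : ℤ, c e = (n : ℝ)}

/-- The Voronoi polytope `Vor_Γ ⊆ H₁(Γ,ℝ)`. -/
def voronoi : Set (Γ.E → ℝ) :=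
  {v | Γ.IsCycle v ∧ ∀ l ∈ Γ.H1Z, Γ.pair v v ≤ Γ.pair (v - l) (v - l)}

/-- A (exposed) face of the Voronoi polytope. -/
def IsVorFace (F : Set (Γ.E → ℝ)) : Prop :=
  ∃ l : (Γ.E → ℝ) →ₗ[ℝ] ℝ, F = {v | v ∈ Γ.voronoi ∧ ∀ w ∈ Γ.voronoi, l w ≤ l v}

/-- The face `F(T,φ)` of the Voronoi polytope associated to `(T,O) ∈ OP_Γ`. -/
def vorFace (T O : Set Γ.E) : Set (Γ.E → ℝ) :=
  {v | v ∈ Γ.voronoi ∧ ∀ γ ∈ Γ.Cir T O,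
      Γ.pair v (Γ.circChainR γ) = Γ.pair (Γ.circChainR γ) (Γ.circChainR γ) / 2}

end SerreGraph


namespace SerreGraph

variable (Γ : SerreGraph)

theorem t_inv (e : Γ.E) : Γ.t (Γ.inv e) = Γ.s e := by
  rw [← Γ.s_inv, Γ.inv_inv]

/-- The elementary skew 1-chain supported on the edge `e` and its reverse. -/
def edgeChain (e : Γ.E) : Γ.E → ℝ :=
  fun f => (if f = e then 1 else 0) - (if f = Γ.inv e then 1 else 0)

theorem edgeChain_inv (e f : Γ.E) : Γ.edgeChain e (Γ.inv f) = - Γ.edgeChain e f := by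
  have h1 : Γ.inv f = e ↔ f = Γ.inv e :=
    ⟨fun h => by rw [← h, Γ.inv_inv], fun h => by rw [h, Γ.inv_inv]⟩
  have h2 : Γ.inv f = Γ.inv e ↔ f = e :=
    ⟨fun h => by rw [← Γ.inv_inv f, h, Γ.inv_inv], fun h => by rw [h]⟩
  simp only [edgeChain, h1, h2]
  ring

theorem edgeChain_self (e : Γ.E) : Γ.edgeChain e e = 1 := by
  simp [edgeChain, (Γ.inv_ne e).symm]

theorem sum_edgeChain (e : Γ.E) (v : Γ.V) :
    ∑ f ∈ Finset.univ.filter (fun f => Γ.t f = v), Γ.edgeChain e f =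
      (if Γ.t e = v then 1 else 0) - (if Γ.s e = v then 1 else 0) := by
  simp [edgeChain, Finset.sum_sub_distrib, Finset.sum_ite_eq', Γ.t_inv]

variable {Γ}

theorem edgeChain_eq_zero {T O : Set Γ.E} (hT : Γ.InvClosed T) (hO : Γ.IsOrientation T O)
    {e f : Γ.E} (he : e ∈ O) (hf : f ∈ T) : Γ.edgeChain e f = 0 := by
  have heT := hO.1 e he
  have h1 : f ≠ e := fun h => heT (h ▸ hf)
  have h2 : f ≠ Γ.inv e := fun h => heT ((hT e).2 (h ▸ hf))
  simp [edgeChain, h1, h2]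

theorem edgeChain_nonneg {T O : Set Γ.E} (hO : Γ.IsOrientation T O)
    {e f : Γ.E} (he : e ∈ O) (hf : f ∈ O) : 0 ≤ Γ.edgeChain e f := by
  have h : f ≠ Γ.inv e := fun h => (hO.2 e (hO.1 e he)).1 he (h ▸ hf)
  simp only [edgeChain, h, if_false, sub_zero]
  split_ifs <;> norm_num

/-- A directed path from `a` to `b` carries a nonnegative flow from `a` to `b`. -/
theorem exists_chain_of_reach {T O : Set Γ.E} (hT : Γ.InvClosed T) (hO : Γ.IsOrientation T O)
    {a b : Γ.V} (h : Γ.Reach O a b) :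
    ∃ c : Γ.E → ℝ, (∀ e, c (Γ.inv e) = - c e) ∧ (∀ e ∈ T, c e = 0) ∧ (∀ e ∈ O, 0 ≤ c e) ∧
      ∀ v, ∑ f ∈ Finset.univ.filter (fun f => Γ.t f = v), c f =
        (if b = v then 1 else 0) - (if a = v then 1 else 0) := by
  induction h with
  | refl => exact ⟨0, by simp⟩
  | tail _ hstep ih =>
    obtain ⟨c, hskew, hzero, hpos, hbd⟩ := ih
    obtain ⟨e, he, rfl, rfl⟩ := hstep
    refine ⟨c + Γ.edgeChain e, fun f => ?_, fun f hf => ?_, fun f hf => ?_, fun v => ?_⟩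
    · simp only [Pi.add_apply, hskew, edgeChain_inv]
      ring
    · simp [hzero f hf, edgeChain_eq_zero hT hO he hf]
    · exact add_nonneg (hpos f hf) (edgeChain_nonneg hO he hf)
    · simp only [Pi.add_apply, Finset.sum_add_distrib, hbd, sum_edgeChain]
      ring

/-- In a totally cyclic orientation, the source of a positive edge is reachable from its target
along positive edges. -/
theorem IsTotallyCyclic.reach {T O : Set Γ.E} (h : Γ.IsTotallyCyclic T O) {e : Γ.E}
    (he : e ∈ O) : Γ.Reach O (Γ.t e) (Γ.s e) := by
  by_contra hn
  refine h.2 ⟨{w | ¬ Γ.Reach O (Γ.t e) w}, ⟨Γ.s e, hn, Γ.t e, ?_, ?_⟩, fun f hf ht hs => ?_⟩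
  · exact fun hw => hw Relation.ReflTransGen.refl
  · exact Relation.ReflTransGen.single ⟨e, h.1.1 e he, rfl, rfl⟩
  · exact ht (Relation.ReflTransGen.tail hs ⟨f, hf, rfl, rfl⟩)

theorem IsTotallyCyclic.exists_mem_sigmaCone_one_le_apply {T O : Set Γ.E} (hT : Γ.InvClosed T)
    (h : Γ.IsTotallyCyclic T O) {e : Γ.E} (he : e ∈ O) :
    ∃ c ∈ Γ.sigmaCone T O, 1 ≤ c e := by
  obtain ⟨c, hskew, hzero, hpos, hbd⟩ := exists_chain_of_reach hT h.1 (h.reach he)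
  refine ⟨c + Γ.edgeChain e, ⟨⟨fun f => ?_, fun v => ?_⟩, fun f hf => ?_, fun f hf => ?_⟩, ?_⟩
  · simp only [Pi.add_apply, hskew, edgeChain_inv]
    ring
  · simp only [Pi.add_apply, Finset.sum_add_distrib, hbd, sum_edgeChain]
    ring
  · exact add_nonneg (hpos f hf) (edgeChain_nonneg h.1 he hf)
  · simp [hzero f hf, edgeChain_eq_zero hT h.1 he hf]
  · simpa [edgeChain_self] using hpos e he

variable (Γ)

/-- `H₁(Γ∖T, ℝ)` as a linear subspace of the space of functions on oriented edges. -/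
def cyclesOn (T : Set Γ.E) : Submodule ℝ (Γ.E → ℝ) where
  carrier := {c | Γ.IsCycleOn T c}
  zero_mem' := by simp [IsCycleOn, IsCycle]
  add_mem' := by
    rintro a b ⟨⟨ha, ha'⟩, ha''⟩ ⟨⟨hb, hb'⟩, hb''⟩
    refine ⟨⟨fun e => ?_, fun v => ?_⟩, fun e he => ?_⟩
    · simp only [Pi.add_apply, ha, hb]
      ring
    · simp [Finset.sum_add_distrib, ha', hb']
    · simp [ha'' e he, hb'' e he]
  smul_mem' := by
    rintro k a ⟨⟨ha, ha'⟩, ha''⟩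
    refine ⟨⟨fun e => ?_, fun v => ?_⟩, fun e he => ?_⟩
    · simp [ha]
    · simp [← Finset.mul_sum, ha']
    · simp [ha'' e he]

variable {Γ}

theorem mem_sigmaCone_iff {T O : Set Γ.E} {c : Γ.E → ℝ} :
    c ∈ Γ.sigmaCone T O ↔ c ∈ Γ.cyclesOn T ∧ ∀ e ∈ O, 0 ≤ c e :=
  ⟨fun h => ⟨⟨h.1, h.2.2⟩, h.2.1⟩, fun h => ⟨h.1.1, h.2, h.1.2⟩⟩

/-- The cone of a totally cyclic orientation contains a cycle that is positive on every
positive edge. -/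
theorem IsTotallyCyclic.exists_mem_sigmaCone_one_le {T O : Set Γ.E} (hT : Γ.InvClosed T)
    (h : Γ.IsTotallyCyclic T O) : ∃ c ∈ Γ.sigmaCone T O, ∀ e ∈ O, 1 ≤ c e := by
  classical
  choose! c hc hc1 using fun e (he : e ∈ O) => h.exists_mem_sigmaCone_one_le_apply hT he
  have hmem : ∀ e ∈ Finset.univ.filter (· ∈ O), c e ∈ Γ.sigmaCone T O :=
    fun e he => hc e (Finset.mem_filter.1 he).2
  refine ⟨∑ e ∈ Finset.univ.filter (· ∈ O), c e, mem_sigmaCone_iff.2 ⟨?_, fun f hf => ?_⟩,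
    fun f hf => ?_⟩
  · exact Submodule.sum_mem _ fun e he => (mem_sigmaCone_iff.1 (hmem e he)).1
  · rw [Finset.sum_apply]
    exact Finset.sum_nonneg fun e he => (hmem e he).2.1 f hf
  · rw [Finset.sum_apply]
    exact (hc1 f hf).trans (Finset.single_le_sum (f := fun e => c e f)
      (fun e he => (hmem e he).2.1 f hf) (by simpa using hf))

theorem IsTotallyCyclic.span_sigmaCone {T O : Set Γ.E} (hT : Γ.InvClosed T)
    (h : Γ.IsTotallyCyclic T O) : Submodule.span ℝ (Γ.sigmaCone T O) = Γ.cyclesOn T := by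
  refine le_antisymm (Submodule.span_le.2 fun c hc => (mem_sigmaCone_iff.1 hc).1) fun c hc => ?_
  obtain ⟨u, hu, hu1⟩ := h.exists_mem_sigmaCone_one_le hT
  have hsum : c + (∑ e, |c e|) • u ∈ Γ.sigmaCone T O := by
    refine mem_sigmaCone_iff.2 ⟨Submodule.add_mem _ hc
      (Submodule.smul_mem _ _ (mem_sigmaCone_iff.1 hu).1), fun e he => ?_⟩
    have hle : |c e| ≤ ∑ e, |c e| :=
      Finset.single_le_sum (f := fun e => |c e|) (fun _ _ => abs_nonneg _) (Finset.mem_univ e)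
    have hmul := le_mul_of_one_le_right ((abs_nonneg (c e)).trans hle) (hu1 e he)
    simp only [Pi.add_apply, Pi.smul_apply, smul_eq_mul]
    linarith [neg_abs_le (c e)]
  rw [← add_sub_cancel_right c ((∑ e, |c e|) • u)]
  exact Submodule.sub_mem _ (Submodule.subset_span hsum)
    (Submodule.smul_mem _ _ (Submodule.subset_span hu))

end SerreGraph

/-- For `(T,φ) ∈ OP_Γ`, the linear span of `σ(T,φ)` equals
`H₁(Γ∖T,ℝ) = ∩_{e ∈ T} {v ∈ H₁(Γ,ℝ) : (v,e⃗) = 0}`, of dimension `b₁(Γ∖T)`. -/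
theorem stmt6 (Γ : SerreGraph) (p : Set Γ.E × Set Γ.E) (hp : p ∈ Γ.OP) :
    (Submodule.span ℝ (Γ.sigmaCone p.1 p.2) : Set (Γ.E → ℝ)) =
      {c | Γ.IsCycleOn p.1 c} ∧
    Module.finrank ℝ (Submodule.span ℝ (Γ.sigmaCone p.1 p.2)) = Γ.b1Sub p.1 := by
  have hspan := SerreGraph.IsTotallyCyclic.span_sigmaCone hp.1 hp.2
  have hset : (Submodule.span ℝ (Γ.sigmaCone p.1 p.2) : Set (Γ.E → ℝ)) =
      {c | Γ.IsCycleOn p.1 c} := by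
    rw [hspan]
    rfl
  refine ⟨hset, ?_⟩
  rw [SerreGraph.b1Sub, ← hset, Submodule.span_eq]
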